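/- Let Δ ⊂ ℝⁿ be a nondegenerate simplex with vertices x₀,…,xₙ, let 2 ≤ k ≤ n+1, and set α_n = ⌊(n+1)/k⌋/(n+1). For every convex f : Δ → ℝ, Avg(f, Δ) ≤ α_n · (1/C(n+1,k)) · Σ_{K ⊂ N, |K| = k} f(b_K) + (1 − α_n) · (f(x₀)+⋯+f(xₙ))/(n+1). -/

import Mathlib

open MeasureTheory

theorem Finset.sum_sub_sum_ite_smul {ι κ V : Type*} [Fintype ι] [Fintype κ] [DecidableEq ι]
    [AddCommGroup V] [Module ℝ V] (l : ι → ℝ) (B : κ → Finset ι) (m : κ → ℝ) (v : ι → V) :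
    ∑ i, (l i - ∑ j, if i ∈ B j then m j else 0) • v i =
      ∑ i, l i • v i - ∑ j, m j • ∑ i ∈ B j, v i := by
  simp only [sub_smul, sum_sub_distrib, sum_smul, ite_smul, zero_smul, smul_sum]
  rw [sum_comm]
  simp

namespace AffineBasis

variable {ι E : Type*} [NormedAddCommGroup E] [NormedSpace ℝ E]

theorem coord_centroid_eq_ite [DecidableEq ι] (b : AffineBasis ι ℝ E) {K : Finset ι}
    (hK : K.Nonempty) (i : ι) :
    b.coord i (K.centroid ℝ b) = if i ∈ K then (K.card : ℝ)⁻¹ else 0 := by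
  split_ifs with hi
  · exact b.coord_apply_centroid hi
  · rw [Finset.centroid_def]
    exact b.coord_apply_combination_of_notMem hi
      (K.sum_centroidWeights_eq_one_of_nonempty ℝ hK)

theorem coord_homothety_centroid [DecidableEq ι] (b : AffineBasis ι ℝ E) {K : Finset ι}
    (hK : K.Nonempty)
    (c : ℝ) (y : E) (i : ι) :
    b.coord i (AffineMap.homothety (K.centroid ℝ b) c y) =
      c * b.coord i y + (1 - c) * if i ∈ K then (K.card : ℝ)⁻¹ else 0 := by
  rw [AffineMap.homothety_eq_lineMap, AffineMap.apply_lineMap, b.coord_centroid_eq_ite hK,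
    AffineMap.lineMap_apply_ring']
  ring

/-- Cutting a simplex by `t ≤ λᵢ` for `i ∈ K` leaves a homothetic copy of it. -/
theorem convexHull_inter_le_coord (b : AffineBasis ι ℝ E) {K : Finset ι} (hK : K.Nonempty)
    {t : ℝ} (ht : 0 ≤ t) (htK : t < (K.card : ℝ)⁻¹) :
    {y | ∀ i ∈ K, t ≤ b.coord i y} ∩ convexHull ℝ (Set.range b) =
      AffineMap.homothety (K.centroid ℝ b) (1 - K.card * t) '' convexHull ℝ (Set.range b) := by
  classical
  have hk : (0 : ℝ) < K.card := by exact_mod_cast hK.card_pos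
  have hc : 0 < 1 - K.card * t := by
    have := mul_lt_mul_of_pos_left htK hk
    rw [mul_inv_cancel₀ hk.ne'] at this
    linarith
  set c := 1 - K.card * t with hcdef
  have hcK : (1 - c) * (K.card : ℝ)⁻¹ = t := by rw [hcdef]; field_simp; ring
  rw [b.convexHull_eq_nonneg_coord]
  ext y
  simp only [Set.mem_inter_iff, Set.mem_ofPred_eq, Set.mem_image]
  constructor
  · rintro ⟨hyK, hy⟩
    refine ⟨AffineMap.homothety (K.centroid ℝ b) c⁻¹ y, fun i => ?_, ?_⟩
    · rw [b.coord_homothety_centroid hK]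
      have key : 0 ≤ b.coord i y - (1 - c) * if i ∈ K then (K.card : ℝ)⁻¹ else 0 := by
        split_ifs with hi
        · rw [hcK]; linarith [hyK i hi]
        · simpa using hy i
      have : c⁻¹ * b.coord i y + (1 - c⁻¹) * (if i ∈ K then (K.card : ℝ)⁻¹ else 0) =
          c⁻¹ * (b.coord i y - (1 - c) * if i ∈ K then (K.card : ℝ)⁻¹ else 0) := by
        field_simp; ring
      rw [this]
      positivity
    · rw [← AffineMap.homothety_mul_apply,
        mul_inv_cancel₀ hc.ne', AffineMap.homothety_one, AffineMap.id_apply]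
  · rintro ⟨z, hz, rfl⟩
    refine ⟨fun i hi => ?_, fun i => ?_⟩
    · rw [b.coord_homothety_centroid hK, if_pos hi, hcK]
      linarith [mul_nonneg hc.le (hz i)]
    · rw [b.coord_homothety_centroid hK]
      have := mul_nonneg hc.le (hz i)
      split_ifs with hi
      · rw [hcK]; linarith
      · simpa using this

variable [Fintype ι]

theorem inf'_coord_le_inv_card (b : AffineBasis ι ℝ E) {K : Finset ι} (hK : K.Nonempty) {y : E}
    (hy : y ∈ convexHull ℝ (Set.range b)) :
    K.inf' hK (fun i => b.coord i y) ≤ (K.card : ℝ)⁻¹ := by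
  rw [b.convexHull_eq_nonneg_coord] at hy
  have hk : (0 : ℝ) < K.card := by exact_mod_cast hK.card_pos
  have h1 : K.card • K.inf' hK (fun i => b.coord i y) ≤ ∑ i ∈ K, b.coord i y :=
    Finset.card_nsmul_le_sum _ _ _ fun i hi => Finset.inf'_le _ hi
  have h2 : ∑ i ∈ K, b.coord i y ≤ ∑ i, b.coord i y :=
    Finset.sum_le_sum_of_subset_of_nonneg (Finset.subset_univ _) fun i _ _ => hy i
  rw [b.sum_coord_apply_eq_one] at h2
  rw [nsmul_eq_mul] at h1
  rw [← one_div, le_div_iff₀' hk]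
  exact h1.trans h2

/-- The bound comes from writing a point of the simplex as a convex combination of the vertices
and the barycenters of the faces `B j`, the latter taken with the largest possible weights. -/
theorem le_sum_add_sum_inf'_coord (b : AffineBasis ι ℝ E) {f : E → ℝ}
    (hf : ConvexOn ℝ (convexHull ℝ (Set.range b)) f) {κ : Type*} [Fintype κ] (B : κ → Finset ι)
    (hB : ∀ j, (B j).Nonempty) (hdisj : Pairwise fun j l => Disjoint (B j) (B l)) {y : E}
    (hy : y ∈ convexHull ℝ (Set.range b)) :
    f y ≤ ∑ i, b.coord i y * f (b i) + ∑ j, (B j).inf' (hB j) (fun i => b.coord i y) *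
      ((B j).card * f (((B j).card : ℝ)⁻¹ • ∑ i ∈ B j, b i) - ∑ i ∈ B j, f (b i)) := by
  classical
  have hy' := hy
  rw [b.convexHull_eq_nonneg_coord] at hy'
  have hvert : ∀ i, b i ∈ convexHull ℝ (Set.range b) :=
    fun i => subset_convexHull ℝ _ (Set.mem_range_self i)
  have hk : ∀ j, (0 : ℝ) < (B j).card := fun j => by exact_mod_cast (hB j).card_pos
  set m : κ → ℝ := fun j => (B j).inf' (hB j) (fun i => b.coord i y)
  have hm0 : ∀ j, 0 ≤ m j := fun j => Finset.le_inf' _ _ fun i _ => hy' i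
  have hrest : ∀ i, 0 ≤ b.coord i y - ∑ j, if i ∈ B j then m j else 0 := by
    intro i
    by_cases h : ∃ j, i ∈ B j
    · obtain ⟨j, hj⟩ := h
      rw [Finset.sum_eq_single j
        (fun l _ hl => if_neg (Finset.disjoint_left.1 (hdisj hl.symm) hj)) (by simp), if_pos hj]
      exact sub_nonneg.2 (Finset.inf'_le _ hj)
    · rw [Finset.sum_eq_zero fun j _ => if_neg fun hj => h ⟨j, hj⟩, sub_zero]
      exact hy' i
  have hjensen := hf.map_sum_le (t := Finset.univ)
    (w := Sum.elim (fun j => (B j).card * m j)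
      fun i => b.coord i y - ∑ j, if i ∈ B j then m j else 0)
    (p := Sum.elim (fun j => ((B j).card : ℝ)⁻¹ • ∑ i ∈ B j, b i) b)
    (by
      rintro (j | i) -
      · exact mul_nonneg (hk j).le (hm0 j)
      · exact hrest i)
    (by
      have h := Finset.sum_sub_sum_ite_smul (fun i => b.coord i y) B m fun _ => (1 : ℝ)
      simp only [smul_eq_mul, mul_one, b.sum_coord_apply_eq_one, Finset.sum_const,
        nsmul_eq_mul] at h
      simp [Fintype.sum_sum_type, h, mul_comm])
    (by
      rintro (j | i) -
      · simp only [Sum.elim_inl, Finset.smul_sum]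
        exact (convex_convexHull ℝ _).sum_mem (fun _ _ => (inv_pos.2 (hk j)).le)
          (by simp [(hk j).ne']) fun i _ => hvert i
      · exact hvert i)
  simp only [Fintype.sum_sum_type, Sum.elim_inl, Sum.elim_inr] at hjensen
  rw [Finset.sum_sub_sum_ite_smul, Finset.sum_sub_sum_ite_smul, b.linear_combination_coord_eq_self,
    Finset.sum_congr rfl fun j _ => show ((B j).card * m j) • ((B j).card : ℝ)⁻¹ •
      ∑ i ∈ B j, b i = m j • ∑ i ∈ B j, b i by
        rw [smul_smul, mul_right_comm, mul_inv_cancel₀ (hk j).ne', one_mul],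
    add_sub_cancel] at hjensen
  refine hjensen.trans_eq ?_
  simp only [smul_eq_mul, mul_sub, Finset.sum_sub_distrib]
  rw [add_sub_left_comm]
  congr 2
  exact Finset.sum_congr rfl fun j _ => by ring

variable [FiniteDimensional ℝ E] [MeasurableSpace E] [BorelSpace E]
  (μ : Measure E) [μ.IsAddHaarMeasure]

theorem setIntegral_inf'_coord (b : AffineBasis ι ℝ E) {K : Finset ι} (hK : K.Nonempty) :
    ∫ y in convexHull ℝ (Set.range b), K.inf' hK (fun i => b.coord i y) ∂μ =
      μ.real (convexHull ℝ (Set.range b)) / (K.card * Fintype.card ι) := by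
  have hk : (0 : ℝ) < K.card := by exact_mod_cast hK.card_pos
  have hcont : Continuous fun y => K.inf' hK (fun i => b.coord i y) :=
    Continuous.finset_inf'_apply hK fun i _ => continuous_barycentric_coord b i
  have hmeas : MeasurableSet (convexHull ℝ (Set.range b)) :=
    ((Set.finite_range b).isCompact_convexHull (𝕜 := ℝ)).measurableSet
  have hint : IntegrableOn (fun y => K.inf' hK (fun i => b.coord i y))
      (convexHull ℝ (Set.range b)) μ :=
    hcont.continuousOn.integrableOn_compact ((Set.finite_range b).isCompact_convexHull (𝕜 := ℝ))
  rw [hint.integral_eq_integral_Ioc_meas_le (M := (K.card : ℝ)⁻¹)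
    ((ae_restrict_iff' hmeas).2 (.of_forall fun y hy => ?_))
    ((ae_restrict_iff' hmeas).2 (.of_forall fun y hy => b.inf'_coord_le_inv_card hK hy))]
  · have hcongr : ∀ t ∈ Set.Ioo (0 : ℝ) (K.card : ℝ)⁻¹,
        (μ.restrict (convexHull ℝ (Set.range b))).real
          {y | t ≤ K.inf' hK (fun i => b.coord i y)} =
        (1 - K.card * t) ^ (Module.finrank ℝ E) * μ.real (convexHull ℝ (Set.range b)) := by
      intro t ht
      have hc : 0 ≤ 1 - K.card * t := by
        have := mul_lt_mul_of_pos_left ht.2 hk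
        rw [mul_inv_cancel₀ hk.ne'] at this
        linarith
      simp only [Finset.le_inf'_iff]
      rw [measureReal_restrict_apply' hmeas, b.convexHull_inter_le_coord hK ht.1.le ht.2,
        Measure.real, Measure.addHaar_image_homothety, ENNReal.toReal_mul,
        ENNReal.toReal_ofReal (abs_nonneg _), abs_of_nonneg (pow_nonneg hc _), Measure.real]
    rw [integral_Ioc_eq_integral_Ioo, setIntegral_congr_fun measurableSet_Ioo hcongr,
      ← integral_Ioc_eq_integral_Ioo, ← intervalIntegral.integral_of_le (by positivity),
      intervalIntegral.integral_mul_const,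
      intervalIntegral.integral_comp_sub_mul (fun s => s ^ Module.finrank ℝ E) hk.ne' 1,
      integral_pow, b.card_eq_finrank_add_one]
    simp [hk.ne']
    field_simp
  · rw [b.convexHull_eq_nonneg_coord] at hy
    exact Finset.le_inf' _ _ fun i _ => hy i

theorem setIntegral_coord (b : AffineBasis ι ℝ E) (i : ι) :
    ∫ y in convexHull ℝ (Set.range b), b.coord i y ∂μ =
      μ.real (convexHull ℝ (Set.range b)) / Fintype.card ι := by
  simpa using b.setIntegral_inf'_coord μ (Finset.singleton_nonempty i)

theorem integrableOn_of_convexOn (b : AffineBasis ι ℝ E) {f : E → ℝ}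
    (hf : ConvexOn ℝ (convexHull ℝ (Set.range b)) f) :
    IntegrableOn f (convexHull ℝ (Set.range b)) μ := by
  have hcpt := (Set.finite_range b).isCompact_convexHull (𝕜 := ℝ)
  have hne : (Finset.univ : Finset ι).Nonempty := Finset.univ_nonempty_iff.2 b.nonempty
  have hN : (0 : ℝ) < Fintype.card ι := by exact_mod_cast Finset.card_pos.2 hne
  have hvert : ∀ i, b i ∈ convexHull ℝ (Set.range b) :=
    fun i => subset_convexHull ℝ _ (Set.mem_range_self i)
  have hae : interior (convexHull ℝ (Set.range b)) =ᵐ[μ] convexHull ℝ (Set.range b) :=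
    interior_ae_eq_of_null_frontier ((convex_convexHull ℝ _).addHaar_frontier μ)
  refine IntegrableOn.of_bound hcpt.measure_lt_top ?_
    (Fintype.card ι * |f ((Fintype.card ι : ℝ)⁻¹ • ∑ i, b i)| + ∑ i, |f (b i)|)
    ((ae_restrict_iff' hcpt.measurableSet).2 (.of_forall fun y hy => ?_))
  · rw [← Measure.restrict_congr_set hae]
    exact hf.continuousOn_interior.aestronglyMeasurable isOpen_interior.measurableSet
  · have hy' := hy
    rw [b.convexHull_eq_nonneg_coord] at hy'
    have hsum := b.sum_coord_apply_eq_one y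
    have hle : ∀ i, b.coord i y ≤ 1 := fun i =>
      hsum ▸ Finset.single_le_sum (fun j _ => hy' j) (Finset.mem_univ i)
    have hupper := hf.map_sum_le (fun i _ => hy' i) hsum (fun i _ => hvert i)
    rw [b.linear_combination_coord_eq_self] at hupper
    have hlower := hf.map_add_sum_le (t := Finset.univ) (v := (Fintype.card ι : ℝ)⁻¹) (q := y)
      (w := fun i => (Fintype.card ι : ℝ)⁻¹ * (1 - b.coord i y)) (p := b)
      (fun i _ => mul_nonneg (by positivity) (by linarith [hle i]))
      (by rw [← Finset.mul_sum, Finset.sum_sub_distrib, hsum]; simp; field_simp; ring)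
      (fun i _ => hvert i) (by positivity) hy
    have hcomb : (Fintype.card ι : ℝ)⁻¹ • y +
        ∑ i, ((Fintype.card ι : ℝ)⁻¹ * (1 - b.coord i y)) • b i =
        (Fintype.card ι : ℝ)⁻¹ • ∑ i, b i := by
      simp only [mul_smul, ← Finset.smul_sum, sub_smul, one_smul, Finset.sum_sub_distrib,
        b.linear_combination_coord_eq_self]
      rw [← smul_add]
      congr 1
      abel
    rw [hcomb] at hlower
    simp only [smul_eq_mul, mul_assoc, ← Finset.mul_sum, ← mul_add] at hlower hupper
    rw [inv_mul_eq_div, le_div_iff₀' hN] at hlower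
    have h1 : ∑ i, b.coord i y * f (b i) ≤ ∑ i, |f (b i)| :=
      Finset.sum_le_sum fun i _ => by
        nlinarith [le_abs_self (f (b i)), abs_nonneg (f (b i)), hy' i, hle i]
    have h2 : ∑ i, (1 - b.coord i y) * f (b i) ≤ ∑ i, |f (b i)| :=
      Finset.sum_le_sum fun i _ => by
        nlinarith [le_abs_self (f (b i)), abs_nonneg (f (b i)), hy' i, hle i]
    have h3 : -(Fintype.card ι * |f ((Fintype.card ι : ℝ)⁻¹ • ∑ i, b i)|) ≤
        Fintype.card ι * f ((Fintype.card ι : ℝ)⁻¹ • ∑ i, b i) := by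
      rw [← mul_neg]
      exact mul_le_mul_of_nonneg_left (neg_abs_le _) hN.le
    have h4 : 0 ≤ Fintype.card ι * |f ((Fintype.card ι : ℝ)⁻¹ • ∑ i, b i)| := by positivity
    rw [Real.norm_eq_abs, abs_le]
    constructor <;> linarith

theorem setAverage_le_of_disjoint (b : AffineBasis ι ℝ E) {f : E → ℝ}
    (hf : ConvexOn ℝ (convexHull ℝ (Set.range b)) f) {κ : Type*} [Fintype κ] (B : κ → Finset ι)
    (hB : ∀ j, (B j).Nonempty) (hdisj : Pairwise fun j l => Disjoint (B j) (B l)) :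
    Fintype.card ι * (⨍ y in convexHull ℝ (Set.range b), f y ∂μ) ≤
      ∑ i, f (b i) + ∑ j, (f (((B j).card : ℝ)⁻¹ • ∑ i ∈ B j, b i) -
        ((B j).card : ℝ)⁻¹ * ∑ i ∈ B j, f (b i)) := by
  have hcpt := (Set.finite_range b).isCompact_convexHull (𝕜 := ℝ)
  have : Nonempty ι := b.nonempty
  have hN : (0 : ℝ) < Fintype.card ι := by exact_mod_cast Fintype.card_pos
  have hk : ∀ j, ((B j).card : ℝ) ≠ 0 := fun j => by exact_mod_cast (hB j).card_pos.ne'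
  have hV : 0 < μ.real (convexHull ℝ (Set.range b)) := by
    refine ENNReal.toReal_pos (Measure.measure_pos_of_nonempty_interior μ ?_).ne'
      hcpt.measure_lt_top.ne
    exact interior_convexHull_nonempty_iff_affineSpan_eq_top.2 b.tot
  have hcoord : ∀ i, IntegrableOn (fun y => b.coord i y * f (b i))
      (convexHull ℝ (Set.range b)) μ := fun i =>
    ((continuous_barycentric_coord b i).continuousOn.integrableOn_compact hcpt).mul_const _
  have hinf : ∀ j, IntegrableOn (fun y => (B j).inf' (hB j) (fun i => b.coord i y) *
      ((B j).card * f (((B j).card : ℝ)⁻¹ • ∑ i ∈ B j, b i) - ∑ i ∈ B j, f (b i)))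
      (convexHull ℝ (Set.range b)) μ := fun j =>
    ((Continuous.finset_inf'_apply (hB j) fun i _ =>
      continuous_barycentric_coord b i).continuousOn.integrableOn_compact hcpt).mul_const _
  have hmono := setIntegral_mono_on (b.integrableOn_of_convexOn μ hf)
    ((integrable_finsetSum (μ := μ.restrict _) _ fun i _ => hcoord i).add
      (integrable_finsetSum (μ := μ.restrict _) _ fun j _ => hinf j))
    hcpt.measurableSet fun y hy => b.le_sum_add_sum_inf'_coord hf B hB hdisj hy
  simp only [Pi.add_apply] at hmono
  rw [integral_add (integrable_finsetSum _ fun i _ => hcoord i)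
    (integrable_finsetSum _ fun j _ => hinf j), integral_finsetSum _ fun i _ => hcoord i,
    integral_finsetSum _ fun j _ => hinf j] at hmono
  simp only [integral_mul_const, b.setIntegral_coord μ, b.setIntegral_inf'_coord μ] at hmono
  rw [setAverage_eq, smul_eq_mul, ← mul_assoc, mul_comm _ (μ.real _)⁻¹, mul_assoc,
    inv_mul_le_iff₀ hV]
  refine (mul_le_mul_of_nonneg_left hmono hN.le).trans_eq ?_
  rw [mul_add, mul_add, Finset.mul_sum, Finset.mul_sum, Finset.mul_sum, Finset.mul_sum]
  congr 1
  · exact Finset.sum_congr rfl fun i _ => by field_simp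
  · exact Finset.sum_congr rfl fun j _ => by have := hk j; field_simp

end AffineBasis

/-- Averaging a function of `k`-subsets over all permutations of one `k`-subset. -/
theorem Finset.choose_mul_sum_perm_map {ι : Type*} [Fintype ι] [DecidableEq ι]
    (g : Finset ι → ℝ) (K : Finset ι) :
    ((Fintype.card ι).choose K.card : ℝ) * ∑ σ : Equiv.Perm ι, g (K.map σ.toEmbedding) =
      (Fintype.card ι).factorial * ∑ L ∈ powersetCard K.card univ, g L := by
  have htrans : ∀ L ∈ powersetCard K.card (univ : Finset ι),
      ∑ σ : Equiv.Perm ι, g (L.map σ.toEmbedding) =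
        ∑ σ : Equiv.Perm ι, g (K.map σ.toEmbedding) := by
    intro L hL
    let e : {x // x ∈ K} ≃ {x // x ∈ L} :=
      Fintype.equivOfCardEq (by simp [(mem_powersetCard.1 hL).2])
    have hτ : K.map e.extendSubtype.toEmbedding = L := by
      refine eq_of_subset_of_card_le (fun x hx => ?_) (by simp [(mem_powersetCard.1 hL).2])
      obtain ⟨z, hz, rfl⟩ := mem_map.1 hx
      exact e.extendSubtype_mem z hz
    rw [← Equiv.sum_comp (Equiv.mulRight e.extendSubtype) fun σ => g (K.map σ.toEmbedding)]
    refine sum_congr rfl fun σ _ => ?_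
    have : K.map (σ * e.extendSubtype : Equiv.Perm ι).toEmbedding = L.map σ.toEmbedding := by
      rw [← congrArg (map σ.toEmbedding) hτ, map_map]
      rfl
    exact congrArg g this.symm
  have hperm : ∀ σ : Equiv.Perm ι, ∑ L ∈ powersetCard K.card univ, g (L.map σ.toEmbedding) =
      ∑ L ∈ powersetCard K.card univ, g L := fun σ => by
    refine sum_bij (fun L _ => L.map σ.toEmbedding) (fun L hL => ?_) (fun L _ M _ h => ?_)
      (fun L hL => ⟨L.map σ.symm.toEmbedding, ?_, ?_⟩) fun _ _ => rfl
    · simpa using hL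
    · exact map_injective _ h
    · simpa using hL
    · ext; simp
  calc _ = ∑ L ∈ powersetCard K.card (univ : Finset ι),
        ∑ σ : Equiv.Perm ι, g (L.map σ.toEmbedding) := by
        rw [sum_congr rfl htrans, sum_const, card_powersetCard, card_univ, nsmul_eq_mul]
    _ = _ := by
        rw [sum_comm, sum_congr rfl fun σ _ => hperm σ, sum_const, card_univ,
          Fintype.card_perm, nsmul_eq_mul]

theorem Finset.card_mul_sum_perm_apply {ι : Type*} [Fintype ι] [DecidableEq ι] (g : ι → ℝ)
    (i : ι) :
    Fintype.card ι * ∑ σ : Equiv.Perm ι, g (σ i) = (Fintype.card ι).factorial * ∑ i, g i := by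
  simpa [powersetCard_one] using choose_mul_sum_perm_map (fun L => ∑ i ∈ L, g i) {i}

theorem exists_disjoint_finsets_card {ι : Type*} [Fintype ι] (k : ℕ) :
    ∃ B : Fin (Fintype.card ι / k) → Finset ι, (∀ j, (B j).card = k) ∧
      Pairwise fun j l => Disjoint (B j) (B l) := by
  obtain ⟨e⟩ : Nonempty (Fin (Fintype.card ι / k) × Fin k ↪ ι) :=
    Function.Embedding.nonempty_of_card_le (by simpa using Nat.div_mul_le_self _ _)
  refine ⟨fun j => Finset.univ.map ((Function.Embedding.sectR j _).trans e), fun j => by simp,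
    fun j l hjl => Finset.disjoint_left.2 fun x hx hx' => hjl ?_⟩
  obtain ⟨p, -, rfl⟩ := Finset.mem_map.1 hx
  obtain ⟨q, -, hq⟩ := Finset.mem_map.1 hx'
  exact (congrArg Prod.fst (e.injective hq)).symm

theorem AffineBasis.setAverage_le_barycenters_vertices {ι E : Type*} [Fintype ι]
    [NormedAddCommGroup E] [NormedSpace ℝ E] [FiniteDimensional ℝ E] [MeasurableSpace E]
    [BorelSpace E] (μ : Measure E) [μ.IsAddHaarMeasure] (b : AffineBasis ι ℝ E) {f : E → ℝ}
    (hf : ConvexOn ℝ (convexHull ℝ (Set.range b)) f) {k : ℕ} (hk : 0 < k)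
    (hkι : k ≤ Fintype.card ι) :
    (⨍ y in convexHull ℝ (Set.range b), f y ∂μ) ≤
      ((Fintype.card ι / k : ℕ) : ℝ) / Fintype.card ι *
          (((Fintype.card ι).choose k : ℝ)⁻¹ *
            ∑ K ∈ Finset.powersetCard k Finset.univ, f ((k : ℝ)⁻¹ • ∑ i ∈ K, b i)) +
        (1 - ((Fintype.card ι / k : ℕ) : ℝ) / Fintype.card ι) *
          ((∑ i, f (b i)) / Fintype.card ι) := by
  classical
  obtain ⟨B, hcard, hdisj⟩ := exists_disjoint_finsets_card (ι := ι) k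
  have hk0 : (k : ℝ) ≠ 0 := by exact_mod_cast hk.ne'
  have hN : (0 : ℝ) < Fintype.card ι := by exact_mod_cast hk.trans_le hkι
  have hC : (0 : ℝ) < (Fintype.card ι).choose k := by exact_mod_cast Nat.choose_pos hkι
  have hfac : (0 : ℝ) < (Fintype.card ι).factorial := by exact_mod_cast Nat.factorial_pos _
  have hbound : ∀ σ : Equiv.Perm ι,
      Fintype.card ι * (⨍ y in convexHull ℝ (Set.range b), f y ∂μ) ≤
        ∑ i, f (b i) + ∑ j, (f ((k : ℝ)⁻¹ • ∑ i ∈ (B j).map σ.toEmbedding, b i) -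
          (k : ℝ)⁻¹ * ∑ i ∈ B j, f (b (σ i))) := by
    intro σ
    simpa [hcard] using b.setAverage_le_of_disjoint μ hf (fun j => (B j).map σ.toEmbedding)
      (fun j => by simpa using Finset.card_pos.1 ((hcard j).symm ▸ hk))
      fun j l hjl => (Finset.disjoint_map _).2 (hdisj hjl)
  have hsum := Finset.sum_le_sum fun σ (_ : σ ∈ Finset.univ) => hbound σ
  set F := ∑ i, f (b i)
  set S := ∑ K ∈ Finset.powersetCard k Finset.univ, f ((k : ℝ)⁻¹ • ∑ i ∈ K, b i)
  have hbary : ∀ j, ∑ σ : Equiv.Perm ι, f ((k : ℝ)⁻¹ • ∑ i ∈ (B j).map σ.toEmbedding, b i) =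
      (Fintype.card ι).factorial * S / (Fintype.card ι).choose k := fun j => by
    have h := Finset.choose_mul_sum_perm_map (fun K => f ((k : ℝ)⁻¹ • ∑ i ∈ K, b i)) (B j)
    rw [hcard] at h
    rw [eq_div_iff hC.ne', mul_comm, h]
  have hvert : ∀ j, ∑ σ : Equiv.Perm ι, ∑ i ∈ B j, f (b (σ i)) =
      k * ((Fintype.card ι).factorial * F / Fintype.card ι) := fun j => by
    rw [Finset.sum_comm, Finset.sum_congr rfl fun i _ => eq_div_of_mul_eq hN.ne'
      ((mul_comm _ _).trans (Finset.card_mul_sum_perm_apply (fun i => f (b i)) i)),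
      Finset.sum_const, hcard, nsmul_eq_mul]
  rw [Finset.sum_const, Finset.sum_add_distrib, Finset.sum_const, Finset.sum_comm] at hsum
  simp only [Finset.sum_sub_distrib, ← Finset.mul_sum, hbary, hvert, Finset.sum_const,
    Finset.card_univ, Fintype.card_perm, Fintype.card_fin, nsmul_eq_mul] at hsum
  rw [← mul_assoc] at hsum
  refine le_of_mul_le_mul_left (hsum.trans_eq ?_) (mul_pos hfac hN)
  field_simp
  ring

theorem avg_le_k_barycenters_vertices (n k : ℕ) (hk2 : 2 ≤ k) (hkn : k ≤ n + 1)
    (x : Fin (n + 1) → EuclideanSpace ℝ (Fin n))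
    (hx : AffineIndependent ℝ x) (f : EuclideanSpace ℝ (Fin n) → ℝ)
    (hf : ConvexOn ℝ (convexHull ℝ (Set.range x)) f) :
    (⨍ y in convexHull ℝ (Set.range x), f y) ≤
      (((n + 1) / k : ℕ) : ℝ) / ((n : ℝ) + 1) *
          ((((n + 1).choose k : ℝ))⁻¹ *
            ∑ K ∈ Finset.powersetCard k (Finset.univ : Finset (Fin (n + 1))),
              f ((k : ℝ)⁻¹ • ∑ i ∈ K, x i)) +
        (1 - (((n + 1) / k : ℕ) : ℝ) / ((n : ℝ) + 1)) * ((∑ i, f (x i)) / ((n : ℝ) + 1)) := by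
  let b : AffineBasis (Fin (n + 1)) ℝ (EuclideanSpace ℝ (Fin n)) :=
    ⟨x, hx, hx.affineSpan_eq_top_iff_card_eq_finrank_add_one.2 (by simp)⟩
  have h := b.setAverage_le_barycenters_vertices volume hf (k := k) (by lia) (by simpa using hkn)
  rw [Fintype.card_fin, Nat.cast_add_one] at h
  exact h
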